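/- Let i = (i(1),…,i(n)) ∈ I_n^ε. Then every partition π ∈ NC^ε[i] has at least one singleton block. -/

import Mathlib

open Finset

/-- A tuple of indices in `I_n^ε`: whenever two entries agree, some entry strictly
between them is different and ε-free from them. -/
def EpsTuple {I : Type*} (ε : I → I → Bool) {n : ℕ} (idx : Fin n → I) : Prop :=
  ∀ k l : Fin n, k < l → idx k = idx l →
    ∃ p : Fin n, k < p ∧ p < l ∧ idx p ≠ idx k ∧ ε (idx k) (idx p) = false

/-- ε-independence of a family of unital subalgebras `S i` of `A` with respect to the
state `φ`: the algebras `S i` and `S j` commute whenever `ε i j = 1`, and centered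
mixed moments along tuples in `I_n^ε` vanish. -/
def EpsIndep {I : Type*} {A : Type*} [Ring A] [Algebra ℂ A]
    (ε : I → I → Bool) (S : I → Subalgebra ℂ A) (φ : A →ₗ[ℂ] ℂ) : Prop :=
  (∀ i j, ε i j = true → ∀ a ∈ S i, ∀ b ∈ S j, a * b = b * a) ∧
  ∀ (n : ℕ) (idx : Fin n → I) (a : Fin n → A),
    EpsTuple ε idx → (∀ k, a k ∈ S (idx k)) → (∀ k, φ (a k) = 0) →
    φ (List.ofFn a).prod = 0
/-- `p` and `q` lie in a common block of `P`. -/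
def SameBlock {n : ℕ} (P : Finset (Finset (Fin n))) (p q : Fin n) : Prop :=
  ∃ V ∈ P, p ∈ V ∧ q ∈ V

/-- `P` is a partition of `{1,…,n}` (modelled on `Fin n`): its blocks are nonempty and
every point lies in exactly one block. -/
def IsPartition {n : ℕ} (P : Finset (Finset (Fin n))) : Prop :=
  (∅ ∉ P) ∧ ∀ k : Fin n, ∃! V, V ∈ P ∧ k ∈ V

/-- `P ≤ ker idx`: every block of `P` is contained in a level set of `idx`. -/
def LeKer {I : Type*} {n : ℕ} (idx : Fin n → I) (P : Finset (Finset (Fin n))) : Prop :=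
  ∀ p q, SameBlock P p q → idx p = idx q

/-- `P` is `(ε, idx)`-non-crossing: every crossing of two blocks happens at indices
`i, j` with `ε i j = 1`. -/
def IsEpsNC {I : Type*} (ε : I → I → Bool) {n : ℕ} (idx : Fin n → I)
    (P : Finset (Finset (Fin n))) : Prop :=
  ∀ p₁ q₁ p₂ q₂ : Fin n, p₁ < q₁ → q₁ < p₂ → p₂ < q₂ →
    SameBlock P p₁ p₂ → SameBlock P q₁ q₂ → ¬ SameBlock P p₁ q₁ →
    ε (idx p₁) (idx q₁) = true

/-- `NC^ε[idx]`: the partitions `P ≤ ker idx` that are `(ε, idx)`-non-crossing. -/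
def NCeps {I : Type*} (ε : I → I → Bool) {n : ℕ} (idx : Fin n → I) :
    Set (Finset (Finset (Fin n))) :=
  {P | IsPartition P ∧ LeKer idx P ∧ IsEpsNC ε idx P}

/-- `P` is non-crossing. -/
def IsNonCrossing {n : ℕ} (P : Finset (Finset (Fin n))) : Prop :=
  ∀ p₁ q₁ p₂ q₂ : Fin n, p₁ < q₁ → q₁ < p₂ → p₂ < q₂ →
    SameBlock P p₁ p₂ → SameBlock P q₁ q₂ → SameBlock P p₁ q₁

/-- `NC(n)`: the set of non-crossing partitions of `{1,…,n}`. -/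
def NCset (n : ℕ) : Set (Finset (Finset (Fin n))) :=
  {P | IsPartition P ∧ IsNonCrossing P}

theorem SameBlock.symm {n : ℕ} {P : Finset (Finset (Fin n))} {p q : Fin n}
    (h : SameBlock P p q) : SameBlock P q p := by
  obtain ⟨V, hV, hp, hq⟩ := h
  exact ⟨V, hV, hq, hp⟩

/-- A point whose singleton is not a block shares its block with another point. -/
theorem IsPartition.exists_ne_sameBlock {n : ℕ} {P : Finset (Finset (Fin n))}
    (hP : IsPartition P) {k : Fin n} (hk : {k} ∉ P) : ∃ s, s ≠ k ∧ SameBlock P k s := by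
  obtain ⟨V, ⟨hV, hkV⟩, -⟩ := hP.2 k
  by_contra! h
  refine hk ?_
  have hVk : V = {k} :=
    Finset.eq_singleton_iff_unique_mem.2
      ⟨hkV, fun s hs => by_contra fun hne => h s hne ⟨V, hV, hkV, hs⟩⟩
  exact hVk ▸ hV

/-- Without singleton blocks, two distinct points of one block enclose two strictly closer
distinct points of one block. -/
theorem EpsTuple.exists_closer_sameBlock {I : Type*} {ε : I → I → Bool}
    (hsym : ∀ i j, ε i j = ε j i) {n : ℕ} {idx : Fin n → I} (hidx : EpsTuple ε idx)
    {P : Finset (Finset (Fin n))} (hP : P ∈ NCeps ε idx) (hsing : ∀ k, {k} ∉ P)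
    {p q : Fin n} (hpq : p < q) (h : SameBlock P p q) :
    ∃ r s, p < r ∧ r < s ∧ s < q ∧ SameBlock P r s := by
  obtain ⟨hpart, hker, hnc⟩ := hP
  have hidx_pq := hker p q h
  obtain ⟨r, hpr, hrq, hne, hε⟩ := hidx p q hpq hidx_pq
  obtain ⟨s, hsr, hrs⟩ := hpart.exists_ne_sameBlock (hsing r)
  have hidx_rs := hker r s hrs
  have hsp : s ≠ p := by rintro rfl; exact hne hidx_rs
  have hsq : s ≠ q := by rintro rfl; exact hne (hidx_rs.trans hidx_pq.symm)
  rcases lt_or_gt_of_ne hsp with hlt | hps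
  · have := hnc s p r q hlt hpr hrq hrs.symm h
      fun hb => hne (hidx_rs.trans (hker s p hb))
    rw [← hidx_rs, hsym, hε] at this
    simp at this
  rcases lt_or_gt_of_ne hsq with hlt | hgt
  · rcases lt_or_gt_of_ne hsr with hs | hs
    · exact ⟨s, r, hps, hs, hrq, hrs.symm⟩
    · exact ⟨r, s, hpr, hs, hlt, hrs⟩
  · have := hnc p r q s hpr hrq hgt h hrs fun hb => hne (hker p r hb).symm
    rw [hε] at this
    simp at this

/-- Without singleton blocks, no two distinct points lie in one block. -/
theorem EpsTuple.not_sameBlock_of_lt {I : Type*} {ε : I → I → Bool}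
    (hsym : ∀ i j, ε i j = ε j i) {n : ℕ} {idx : Fin n → I} (hidx : EpsTuple ε idx)
    {P : Finset (Finset (Fin n))} (hP : P ∈ NCeps ε idx) (hsing : ∀ k, {k} ∉ P)
    (p q : Fin n) (hpq : p < q) : ¬ SameBlock P p q := by
  intro h
  obtain ⟨r, s, hpr, hrs, hsq, hb⟩ := hidx.exists_closer_sameBlock hsym hP hsing hpq h
  exact hidx.not_sameBlock_of_lt hsym hP hsing r s hrs hb
termination_by q.val - p.val
decreasing_by omega

/-- If the tuple `idx` belongs to `I_n^ε` (with `n ≥ 1`), then every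
partition in `NC^ε[idx]` has at least one singleton block. -/
theorem NCeps_of_epsTuple_has_singleton {I : Type*} (ε : I → I → Bool)
    (hsym : ∀ i j, ε i j = ε j i) (hdiag : ∀ i, ε i i = false)
    (n : ℕ) (hn : 0 < n) (idx : Fin n → I) (hidx : EpsTuple ε idx) :
    ∀ P ∈ NCeps ε idx, ∃ k : Fin n, ({k} : Finset (Fin n)) ∈ P := by
  intro P hP
  by_contra! hsing
  obtain ⟨s, hs, hb⟩ := hP.1.exists_ne_sameBlock (hsing ⟨0, hn⟩)
  rcases lt_or_gt_of_ne hs with h | h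
  · exact hidx.not_sameBlock_of_lt hsym hP hsing _ _ h hb.symm
  · exact hidx.not_sameBlock_of_lt hsym hP hsing _ _ h hb
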